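/- arXiv:2405.05503 — 3 statements merged into one kernel-verified Lean document; each statement's English description precedes it below -/
import Mathlib

section
/- Let p ≥ 1 be an integer, α > 0, Σ ∈ ℝ^{p×p} symmetric positive definite, v ∈ ℝ^p nonzero, and τ ∈ ℝ. With k₂ = Γ((α+p)/2)/(Γ(α/2)(απ)^{p/2}√(det Σ)) and c_α = Γ((α+1)/2)/(Γ(α/2)√(απ)), it holds that ∫_{{n ∈ ℝ^p : vᵀn > τ}} k₂·(1 + nᵀΣ⁻¹n/α)^{−(α+p)/2} dn = c_α·∫_{τ/√(vᵀΣv)}^∞ (1 + t²/α)^{−(α+1)/2} dt. -/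
open Matrix Real MeasureTheory

theorem Matrix.PosDef.exists_transpose_mul_self {n : Type*} [Fintype n] [DecidableEq n]
    {A : Matrix n n ℝ} (hA : A.PosDef) : ∃ C : Matrix n n ℝ, A = Cᵀ * C := by
  open scoped MatrixOrder Matrix.Norms.L2Operator in
  obtain ⟨B, hB⟩ := CStarAlgebra.nonneg_iff_eq_star_mul_self.mp hA.posSemidef.nonneg
  exact ⟨B, by rw [hB, star_eq_conjTranspose, conjTranspose_eq_transpose_of_trivial]⟩

/-- Rotating the first coordinate axis onto the direction of `w`. -/
theorem lintegral_comp_dotProduct_dotProduct_self {m : ℕ} (w : Fin (m + 1) → ℝ)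
    (F : ℝ → ℝ → ENNReal) :
    ∫⁻ z : Fin (m + 1) → ℝ, F (w ⬝ᵥ z) (z ⬝ᵥ z) =
      ∫⁻ y : Fin (m + 1) → ℝ, F (√(w ⬝ᵥ w) * y 0) (y ⬝ᵥ y) := by
  set W : EuclideanSpace ℝ (Fin (m + 1)) := WithLp.toLp 2 w with hW
  set e : EuclideanSpace ℝ (Fin (m + 1)) := EuclideanSpace.single 0 ‖W‖ with he
  have hnorm : ‖e‖ = ‖W‖ := by simp [he]
  have hWw : ‖W‖ = √(w ⬝ᵥ w) := by
    simp [hW, EuclideanSpace.norm_eq, dotProduct, sq]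
  set U := Submodule.reflection (ℝ ∙ (e - W))ᗮ with hU
  have hUe : U e = W := Submodule.reflection_sub hnorm
  have hin (x y : EuclideanSpace ℝ (Fin (m + 1))) : inner ℝ x y = x.ofLp ⬝ᵥ y.ofLp := by
    simp [PiLp.inner_apply, dotProduct, mul_comm]
  have h₁ := (PiLp.volume_preserving_ofLp (Fin (m + 1))).lintegral_comp_emb
    (MeasurableEquiv.toLp 2 (Fin (m + 1) → ℝ)).symm.measurableEmbedding
  rw [← h₁ (fun z => F (w ⬝ᵥ z) (z ⬝ᵥ z)),
    ← h₁ (fun y => F (√(w ⬝ᵥ w) * y 0) (y ⬝ᵥ y)),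
    ← U.measurePreserving.lintegral_comp_emb U.toHomeomorph.measurableEmbedding]
  refine lintegral_congr fun y => ?_
  have h₂ : w ⬝ᵥ (U y).ofLp = √(w ⬝ᵥ w) * y 0 := by
    have : inner ℝ W (U y) = inner ℝ e y := by rw [← hUe, U.inner_map_map]
    rw [hin, hin] at this
    rw [← hWw]
    simpa [he, hW] using this
  have h₃ : (U y).ofLp ⬝ᵥ (U y).ofLp = y.ofLp ⬝ᵥ y.ofLp := by
    rw [← hin, ← hin, U.inner_map_map]
  rw [h₂, h₃]

theorem lintegral_comp_dotProduct_inv_quadForm {m : ℕ} {A : Matrix (Fin (m + 1)) (Fin (m + 1)) ℝ}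
    (hA : A.PosDef) (v : Fin (m + 1) → ℝ) {F : ℝ → ℝ → ENNReal}
    (hF : Measurable (Function.uncurry F)) :
    ∫⁻ x : Fin (m + 1) → ℝ, F (v ⬝ᵥ x) (x ⬝ᵥ (A⁻¹ *ᵥ x)) =
      ENNReal.ofReal √A.det *
        ∫⁻ y : Fin (m + 1) → ℝ, F (√(v ⬝ᵥ (A *ᵥ v)) * y 0) (y ⬝ᵥ y) := by
  obtain ⟨C, hC⟩ := hA.exists_transpose_mul_self
  have hdet : A.det = C.det ^ 2 := by rw [hC, det_mul, det_transpose, sq]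
  have hCdet : C.det ≠ 0 := by
    intro h
    have := hA.det_pos
    simp [hdet, h] at this
  have hCu : IsUnit C.det := hCdet.isUnit
  have hvv : v ⬝ᵥ (A *ᵥ v) = (C *ᵥ v) ⬝ᵥ (C *ᵥ v) := by
    rw [hC, ← mulVec_mulVec, dotProduct_mulVec, vecMul_transpose]
  rw [hvv, ← lintegral_comp_dotProduct_dotProduct_self]
  have hmap := Real.map_matrix_volume_pi_eq_smul_volume_pi (M := Cᵀ) (by rwa [det_transpose])
  have hmeas : Measurable (fun x : Fin (m + 1) → ℝ => F (v ⬝ᵥ x) (x ⬝ᵥ (A⁻¹ *ᵥ x))) := by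
    refine hF.comp (Measurable.prodMk ?_ ?_)
    · exact (by fun_prop : Continuous fun x : Fin (m + 1) → ℝ => v ⬝ᵥ x).measurable
    · exact (by fun_prop : Continuous fun x : Fin (m + 1) → ℝ => x ⬝ᵥ (A⁻¹ *ᵥ x)).measurable
  have hlin : Measurable (toLin' Cᵀ) := (LinearMap.continuous_of_finiteDimensional _).measurable
  have key := lintegral_map (μ := volume) hmeas hlin
  rw [hmap, lintegral_smul_measure] at key
  have hz (z : Fin (m + 1) → ℝ) :
      F (v ⬝ᵥ (toLin' Cᵀ z)) ((toLin' Cᵀ z) ⬝ᵥ (A⁻¹ *ᵥ (toLin' Cᵀ z))) =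
        F ((C *ᵥ v) ⬝ᵥ z) (z ⬝ᵥ z) := by
    have h₁ : v ⬝ᵥ (Cᵀ *ᵥ z) = (C *ᵥ v) ⬝ᵥ z := by
      rw [dotProduct_mulVec, vecMul_transpose]
    have h₂ : A⁻¹ *ᵥ (Cᵀ *ᵥ z) = C⁻¹ *ᵥ z := by
      rw [hC, Matrix.mul_inv_rev, mulVec_mulVec, Matrix.mul_assoc,
        nonsing_inv_mul _ (by rwa [det_transpose]), Matrix.mul_one]
    have h₃ : (Cᵀ *ᵥ z) ⬝ᵥ (C⁻¹ *ᵥ z) = z ⬝ᵥ z := by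
      rw [mulVec_transpose, ← dotProduct_mulVec, mulVec_mulVec, mul_nonsing_inv _ hCu, one_mulVec]
    rw [toLin'_apply, h₁, h₂, h₃]
  simp_rw [hz] at key
  rw [← key, hdet, Real.sqrt_sq_eq_abs, smul_eq_mul, ← mul_assoc,
    ← ENNReal.ofReal_mul (abs_nonneg _),
    det_transpose, ← abs_mul, mul_inv_cancel₀ hCdet]
  simp

theorem lintegral_fin_succ_mul {m : ℕ} {g : ℝ → ENNReal} {h : (Fin m → ℝ) → ENNReal}
    (hg : Measurable g) (hh : Measurable h) :
    ∫⁻ y : Fin (m + 1) → ℝ, g (y 0) * h (Fin.tail y) = (∫⁻ t, g t) * ∫⁻ y, h y := by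
  rw [← lintegral_prod_mul hg.aemeasurable hh.aemeasurable]
  exact (volume_preserving_piFinSuccAbove (fun _ : Fin (m + 1) => ℝ) 0).lintegral_comp
    (f := fun z : ℝ × (Fin m → ℝ) => g z.1 * h z.2) (by fun_prop)

theorem dotProduct_self_fin_succ {m : ℕ} (y : Fin (m + 1) → ℝ) :
    y ⬝ᵥ y = y 0 ^ 2 + Fin.tail y ⬝ᵥ Fin.tail y := by
  simp [dotProduct, Fin.sum_univ_succ, Fin.tail, sq]

theorem dotProduct_self_nonneg {n : Type*} [Fintype n] (y : n → ℝ) : 0 ≤ y ⬝ᵥ y :=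
  Finset.sum_nonneg fun _ _ => mul_self_nonneg _

theorem measurable_gaussian_dotProduct_self {m : ℕ} (b : ℝ) :
    Measurable fun y : Fin m → ℝ => ENNReal.ofReal (exp (-b * (y ⬝ᵥ y))) :=
  ENNReal.measurable_ofReal.comp
    (by fun_prop : Continuous fun y : Fin m → ℝ => exp (-b * (y ⬝ᵥ y))).measurable

theorem lintegral_gaussian {b : ℝ} (hb : 0 < b) :
    ∫⁻ t : ℝ, ENNReal.ofReal (exp (-b * t ^ 2)) = ENNReal.ofReal √(π / b) := by
  rw [← ofReal_integral_eq_lintegral_ofReal (integrable_exp_neg_mul_sq hb)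
    (ae_of_all _ fun t => (exp_pos _).le), integral_gaussian]

theorem lintegral_gaussian_pi {b : ℝ} (hb : 0 < b) (m : ℕ) :
    ∫⁻ y : Fin m → ℝ, ENNReal.ofReal (exp (-b * (y ⬝ᵥ y))) = ENNReal.ofReal (√(π / b) ^ m) := by
  induction m with
  | zero => simp [volume_pi]
  | succ m ih =>
    have h := lintegral_fin_succ_mul (m := m) (g := fun t => ENNReal.ofReal (exp (-b * t ^ 2)))
      (by fun_prop) (measurable_gaussian_dotProduct_self b)
    rw [ih, lintegral_gaussian hb, ← ENNReal.ofReal_mul (by positivity), ← pow_succ'] at h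
    rw [← h]
    refine lintegral_congr fun y => ?_
    rw [dotProduct_self_fin_succ, mul_add, exp_add, ENNReal.ofReal_mul (exp_pos _).le]

theorem setLIntegral_gaussian_halfspace {b : ℝ} (hb : 0 < b) (m : ℕ) (c : ℝ) :
    ∫⁻ y in {y : Fin (m + 1) → ℝ | c < y 0}, ENNReal.ofReal (exp (-b * (y ⬝ᵥ y))) =
      ENNReal.ofReal (√(π / b) ^ m) *
        ∫⁻ t in Set.Ioi c, ENNReal.ofReal (exp (-b * t ^ 2)) := by
  have h := lintegral_fin_succ_mul (m := m)
    (g := (Set.Ioi c).indicator fun t => ENNReal.ofReal (exp (-b * t ^ 2)))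
    ((by fun_prop : Measurable fun t => ENNReal.ofReal (exp (-b * t ^ 2))).indicator
      measurableSet_Ioi) (measurable_gaussian_dotProduct_self b)
  rw [lintegral_gaussian_pi hb, lintegral_indicator measurableSet_Ioi] at h
  rw [mul_comm, ← h, ← lintegral_indicator (measurableSet_lt measurable_const (measurable_pi_apply 0))]
  refine lintegral_congr fun y => ?_
  by_cases hy : c < y 0
  · simp only [Set.indicator, Set.mem_ofPred_eq, Set.mem_Ioi, hy, if_true]
    rw [dotProduct_self_fin_succ, mul_add, exp_add, ENNReal.ofReal_mul (exp_pos _).le]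
  · simp [Set.indicator, hy]

/-- The density `(1 + q / α) ^ (-a)` as a Gamma mixture of exponentials. -/
theorem setLIntegral_gamma_mixture {α a q : ℝ} (hα : 0 < α) (ha : 0 < a) (hq : 0 ≤ q) :
    ∫⁻ s in Set.Ioi 0, ENNReal.ofReal (s ^ (a - 1) * exp (-s)) *
        ENNReal.ofReal (exp (-(s / α) * q)) =
      ENNReal.ofReal (Gamma a) * ENNReal.ofReal ((1 + q / α) ^ (-a)) := by
  have hr : 0 < 1 + q / α := by positivity
  have hint : IntegrableOn (fun s : ℝ => s ^ (a - 1) * exp (-((1 + q / α) * s))) (Set.Ioi 0) := by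
    simpa only [rpow_one, neg_mul] using
      integrableOn_rpow_mul_exp_neg_mul_rpow (p := 1) (s := a - 1) (by linarith) one_pos hr
  rw [← ENNReal.ofReal_mul (Gamma_pos_of_pos ha).le, rpow_neg hr.le, ← inv_rpow hr.le, inv_eq_one_div,
    mul_comm (Gamma a), ← integral_rpow_mul_exp_neg_mul_Ioi ha hr,
    ofReal_integral_eq_lintegral_ofReal hint]
  · refine setLIntegral_congr_fun measurableSet_Ioi fun s (hs : 0 < s) => ?_
    rw [← ENNReal.ofReal_mul (by positivity), mul_assoc, ← exp_add]
    congr 3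
    ring_nf
  · filter_upwards [ae_restrict_mem measurableSet_Ioi] with s (hs : 0 < s)
    simp only [Pi.zero_apply]
    positivity

theorem gamma_weight_mul_gaussian_mass {α s : ℝ} (hα : 0 < α) (hs : 0 < s) (m : ℕ) :
    s ^ ((α + (m + 1 : ℕ)) / 2 - 1) * exp (-s) * √(π / (s / α)) ^ m =
      (α * π) ^ ((m : ℝ) / 2) * (s ^ ((α + 1) / 2 - 1) * exp (-s)) := by
  have h₁ : √(π / (s / α)) ^ m = (α * π) ^ ((m : ℝ) / 2) * s ^ (-((m : ℝ) / 2)) := by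
    rw [← rpow_natCast, sqrt_eq_rpow, ← rpow_mul (by positivity), rpow_neg hs.le, ← div_eq_mul_inv,
      ← div_rpow (by positivity) hs.le]
    congr 1
    · field_simp
    · ring
  have h₂ : s ^ ((α + 1) / 2 - 1) = s ^ ((α + (m + 1 : ℕ)) / 2 - 1) * s ^ (-((m : ℝ) / 2)) := by
    rw [← rpow_add hs]
    congr 1
    push_cast
    ring
  rw [h₁, h₂]
  ring

theorem setLIntegral_student_halfspace {α : ℝ} (hα : 0 < α) (m : ℕ) (c : ℝ) :
    ENNReal.ofReal (Gamma ((α + (m + 1 : ℕ)) / 2)) *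
        ∫⁻ y in {y : Fin (m + 1) → ℝ | c < y 0},
          ENNReal.ofReal ((1 + (y ⬝ᵥ y) / α) ^ (-((α + (m + 1 : ℕ)) / 2))) =
      ENNReal.ofReal ((α * π) ^ ((m : ℝ) / 2)) * (ENNReal.ofReal (Gamma ((α + 1) / 2)) *
        ∫⁻ t in Set.Ioi c, ENNReal.ofReal ((1 + t ^ 2 / α) ^ (-((α + 1) / 2)))) := by
  rw [← lintegral_const_mul' _ _ ENNReal.ofReal_ne_top,
    ← lintegral_const_mul' _ _ ENNReal.ofReal_ne_top]
  have h₁ (t : ℝ) :=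
    setLIntegral_gamma_mixture hα (by positivity : 0 < (α + 1) / 2) (sq_nonneg t)
  have h₂ (y : Fin (m + 1) → ℝ) :=
    setLIntegral_gamma_mixture hα (by positivity : 0 < (α + (m + 1 : ℕ)) / 2)
      (dotProduct_self_nonneg y)
  simp_rw [← h₁, ← h₂]
  rw [lintegral_lintegral_swap (by fun_prop)]
  conv_rhs => rw [lintegral_lintegral_swap (by fun_prop)]
  rw [← lintegral_const_mul' _ _ ENNReal.ofReal_ne_top]
  refine setLIntegral_congr_fun measurableSet_Ioi fun s (hs : 0 < s) => ?_
  rw [lintegral_const_mul' _ _ ENNReal.ofReal_ne_top, lintegral_const_mul' _ _ ENNReal.ofReal_ne_top,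
    setLIntegral_gaussian_halfspace (by positivity), ← mul_assoc, ← mul_assoc,
    ← ENNReal.ofReal_mul (by positivity), ← ENNReal.ofReal_mul (by positivity),
    gamma_weight_mul_gaussian_mass hα hs]

/-- Half-space marginalization of the multivariate Student-t density: for nonzero `v` and
threshold `τ`, `∫_{vᵀn > τ} k₂(1 + nᵀΣ⁻¹n/α)^{−(α+p)/2} dn
  = c_α ∫_{τ/√(vᵀΣv)}^∞ (1 + t²/α)^{−(α+1)/2} dt`. -/
theorem student_halfspace_marginalization (p : ℕ) (hp : 1 ≤ p) (α : ℝ) (hα : 0 < α)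
    (Cov : Matrix (Fin p) (Fin p) ℝ) (hCov : Cov.PosDef)
    (v : Fin p → ℝ) (hv : v ≠ 0) (τ : ℝ) :
    (∫ n in {n : Fin p → ℝ | v ⬝ᵥ n > τ},
        (Real.Gamma ((α + p) / 2) /
            (Real.Gamma (α / 2) * (α * π) ^ ((p : ℝ) / 2) * Real.sqrt Cov.det)) *
          (1 + (n ⬝ᵥ (Cov⁻¹ *ᵥ n)) / α) ^ (-(α + (p : ℝ)) / 2))
      = (Real.Gamma ((α + 1) / 2) / (Real.Gamma (α / 2) * Real.sqrt (α * π))) *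
          ∫ t in Set.Ioi (τ / Real.sqrt (v ⬝ᵥ (Cov *ᵥ v))),
            (1 + t ^ 2 / α) ^ (-(α + 1) / 2) := by
  obtain ⟨m, rfl⟩ : ∃ m, p = m + 1 := ⟨p - 1, by omega⟩
  have hσ : 0 < √(v ⬝ᵥ (Cov *ᵥ v)) := by
    have := hCov.dotProduct_mulVec_pos hv
    rw [star_trivial] at this
    exact sqrt_pos.mpr this
  have hdet : 0 < √Cov.det := sqrt_pos.mpr hCov.det_pos
  have hquad (x : Fin (m + 1) → ℝ) : 0 ≤ x ⬝ᵥ (Cov⁻¹ *ᵥ x) := by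
    simpa using hCov.inv.posSemidef.dotProduct_mulVec_nonneg x
  have hquadc : Continuous fun x : Fin (m + 1) → ℝ => x ⬝ᵥ (Cov⁻¹ *ᵥ x) := by fun_prop
  have hlin : Continuous fun x : Fin (m + 1) → ℝ => v ⬝ᵥ x := by fun_prop
  have hset : MeasurableSet {n : Fin (m + 1) → ℝ | v ⬝ᵥ n > τ} :=
    measurableSet_lt measurable_const hlin.measurable
  have hF : Measurable (Function.uncurry fun u q : ℝ => (Set.Ioi τ).indicator
      (fun _ => ENNReal.ofReal ((1 + q / α) ^ (-((α + (m + 1 : ℕ)) / 2)))) u) := by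
    have : Measurable (({z : ℝ × ℝ | τ < z.1}).indicator
        fun z => ENNReal.ofReal ((1 + z.2 / α) ^ (-((α + (m + 1 : ℕ)) / 2)))) :=
      (by fun_prop : Measurable fun z : ℝ × ℝ =>
        ENNReal.ofReal ((1 + z.2 / α) ^ (-((α + (m + 1 : ℕ)) / 2)))).indicator
        (measurableSet_lt measurable_const measurable_fst)
    exact this
  have hreduce := lintegral_comp_dotProduct_inv_quadForm hCov v hF
  have hleft : ∫⁻ n in {n : Fin (m + 1) → ℝ | v ⬝ᵥ n > τ},
      ENNReal.ofReal ((1 + (n ⬝ᵥ (Cov⁻¹ *ᵥ n)) / α) ^ (-((α + (m + 1 : ℕ)) / 2))) =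
      ENNReal.ofReal √Cov.det *
        ∫⁻ y in {y : Fin (m + 1) → ℝ | τ / √(v ⬝ᵥ (Cov *ᵥ v)) < y 0},
          ENNReal.ofReal ((1 + (y ⬝ᵥ y) / α) ^ (-((α + (m + 1 : ℕ)) / 2))) := by
    rw [← lintegral_indicator hset, ← lintegral_indicator
      (measurableSet_lt measurable_const (measurable_pi_apply 0))]
    refine Eq.trans rfl (hreduce.trans (congrArg _ (lintegral_congr fun y => ?_)))
    simp only [Set.indicator, Set.mem_ofPred_eq, Set.mem_Ioi, div_lt_iff₀' hσ]
  have hstudent := congrArg ENNReal.toReal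
    (setLIntegral_student_halfspace hα m (τ / √(v ⬝ᵥ (Cov *ᵥ v))))
  have hleft' := congrArg ENNReal.toReal hleft
  have hΓm : 0 < Gamma ((α + (m + 1 : ℕ)) / 2) := Gamma_pos_of_pos (by positivity)
  have hΓ1 : 0 < Gamma ((α + 1) / 2) := Gamma_pos_of_pos (by positivity)
  have hΓ : 0 < Gamma (α / 2) := Gamma_pos_of_pos (by positivity)
  simp only [ENNReal.toReal_mul, ENNReal.toReal_ofReal hdet.le, ENNReal.toReal_ofReal hΓm.le,
    ENNReal.toReal_ofReal hΓ1.le,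
    ENNReal.toReal_ofReal (by positivity : 0 ≤ (α * π) ^ ((m : ℝ) / 2))] at hstudent hleft'
  rw [integral_const_mul]
  simp only [neg_div]
  rw [integral_eq_lintegral_of_nonneg_ae (ae_of_all _ fun n => by
        have := hquad n
        simp only [Pi.zero_apply]
        positivity)
      (Measurable.aestronglyMeasurable (by have := hquadc.measurable; fun_prop)),
    integral_eq_lintegral_of_nonneg_ae (ae_of_all _ fun t => by
        simp only [Pi.zero_apply]
        positivity)
      (Measurable.aestronglyMeasurable (by fun_prop)), hleft']
  have hpow : (α * π) ^ (((m + 1 : ℕ) : ℝ) / 2) = (α * π) ^ ((m : ℝ) / 2) * √(α * π) := by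
    rw [sqrt_eq_rpow, ← rpow_add (by positivity)]
    congr 1
    push_cast
    ring
  rw [hpow]
  clear hreduce hleft hleft'
  generalize (∫⁻ y in {y : Fin (m + 1) → ℝ | τ / √(v ⬝ᵥ (Cov *ᵥ v)) < y 0},
    ENNReal.ofReal ((1 + (y ⬝ᵥ y) / α) ^ (-((α + (m + 1 : ℕ)) / 2)))).toReal = I at *
  generalize (∫⁻ t in Set.Ioi (τ / √(v ⬝ᵥ (Cov *ᵥ v))),
    ENNReal.ofReal ((1 + t ^ 2 / α) ^ (-((α + 1) / 2)))).toReal = J at *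
  have hπ : 0 < √(α * π) := sqrt_pos.mpr (by positivity)
  have hπm : 0 < (α * π) ^ ((m : ℝ) / 2) := by positivity
  field_simp
  linear_combination hstudent
end

section
/- (Theorem 3.) Let p ≥ 2 be an integer, α > 0, ρ ∈ [0,1], Σ ∈ ℝ^{p×p} symmetric positive definite, and A > 0. Set P₀ = A·e_pᵀΣ⁻¹e_p, λ = √(e_pᵀΣ⁻¹e_p) (so that P₀/λ = A·√(e_pᵀΣ⁻¹e_p)), k₂ = Γ((α+p)/2)/(Γ(α/2)(απ)^{p/2}√(det Σ)) and c_α = Γ((α+1)/2)/(Γ(α/2)√(απ)). Then the asymptotic bit error probability P̂_e = ∫_{{n : e_pᵀΣ⁻¹n < −P₀}} (1−ρ)·k₂·(1 + nᵀΣ⁻¹n/α)^{−(α+p)/2} dn of ML demodulation of BPSK (and QPSK) in GS bursty mixed noise satisfies P̂_e = (1−ρ)·[1/2 − c_α·∫₀^{P₀/λ} (1 + t²/α)^{−(α+1)/2} dt]. -/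
open Matrix Real MeasureTheory

open scoped ENNReal

/-- The Gamma function integral represents a negative power as a mixture of exponentials. -/
lemma lintegral_mul_one_add_rpow_neg {X : Type*} [MeasurableSpace X] (μ : Measure X) [SFinite μ]
    {g : X → ℝ≥0∞} {q : X → ℝ} (hg : Measurable g) (hq : Measurable q) (hq0 : ∀ x, 0 ≤ q x)
    {β : ℝ} (hβ : 0 < β) :
    ENNReal.ofReal (Real.Gamma β) * ∫⁻ x, g x * ENNReal.ofReal ((1 + q x) ^ (-β)) ∂μ =
      ∫⁻ s in Set.Ioi (0 : ℝ), ENNReal.ofReal (s ^ (β - 1) * exp (-s)) *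
        ∫⁻ x, g x * ENNReal.ofReal (exp (-(s * q x))) ∂μ := by
  have hΓ := Real.Gamma_pos_of_pos hβ
  have key (x : X) : ENNReal.ofReal (Real.Gamma β) * ENNReal.ofReal ((1 + q x) ^ (-β)) =
      ∫⁻ s in Set.Ioi (0 : ℝ), ENNReal.ofReal (s ^ (β - 1) * exp (-s)) *
        ENNReal.ofReal (exp (-(s * q x))) := by
    have h1 : 0 < 1 + q x := by linarith [hq0 x]
    have hint := Real.integral_rpow_mul_exp_neg_mul_Ioi hβ h1
    have hi : IntegrableOn (fun s : ℝ => s ^ (β - 1) * exp (-((1 + q x) * s))) (Set.Ioi 0) :=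
      Integrable.of_integral_ne_zero (by rw [hint]; positivity)
    have hval : Real.Gamma β * (1 + q x) ^ (-β) =
        ∫ s in Set.Ioi (0 : ℝ), s ^ (β - 1) * exp (-((1 + q x) * s)) := by
      rw [hint, one_div, Real.inv_rpow h1.le, Real.rpow_neg h1.le, mul_comm]
    rw [← ENNReal.ofReal_mul hΓ.le, hval, ofReal_integral_eq_lintegral_ofReal hi]
    · refine setLIntegral_congr_fun measurableSet_Ioi fun s hs => ?_
      have hs' : (0 : ℝ) < s := hs
      rw [← ENNReal.ofReal_mul (by positivity), mul_assoc, ← Real.exp_add]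
      congr 3
      ring
    · filter_upwards [ae_restrict_mem measurableSet_Ioi] with s hs
      have hs' : (0 : ℝ) < s := hs
      simp only [Pi.zero_apply]
      positivity
  calc _ = ∫⁻ x, (∫⁻ s in Set.Ioi (0 : ℝ), g x * (ENNReal.ofReal (s ^ (β - 1) * exp (-s)) *
        ENNReal.ofReal (exp (-(s * q x))))) ∂μ := by
        rw [← lintegral_const_mul _ (by fun_prop)]
        refine lintegral_congr fun x => ?_
        rw [lintegral_const_mul _ (by fun_prop), ← key]
        ring
    _ = ∫⁻ s in Set.Ioi (0 : ℝ), (∫⁻ x, g x * (ENNReal.ofReal (s ^ (β - 1) * exp (-s)) *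
        ENNReal.ofReal (exp (-(s * q x)))) ∂μ) :=
        lintegral_lintegral_swap (by fun_prop)
    _ = _ := by
        refine lintegral_congr fun s => ?_
        rw [← lintegral_const_mul _ (by fun_prop)]
        refine lintegral_congr fun x => ?_
        ring

lemma lintegral_exp_neg_mul_sum_sq (m : ℕ) {b : ℝ} (hb : 0 < b) :
    ∫⁻ y : Fin m → ℝ, ENNReal.ofReal (exp (-(b * ∑ i, y i ^ 2))) =
      ENNReal.ofReal (√(π / b) ^ m) := by
  have h : ∫ y : Fin m → ℝ, exp (-(b * ∑ i, y i ^ 2)) = √(π / b) ^ m := by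
    have := integral_fintype_prod_volume_eq_pow (ι := Fin m) (fun x : ℝ => exp (-b * x ^ 2))
    rw [integral_gaussian, Fintype.card_fin] at this
    rw [← this]
    congr 1 with y
    rw [← Real.exp_sum, Finset.mul_sum, ← Finset.sum_neg_distrib]
    simp
  rw [← h, ofReal_integral_eq_lintegral_ofReal]
  · exact Integrable.of_integral_ne_zero (by rw [h]; positivity)
  · exact Filter.Eventually.of_forall fun y => (exp_pos _).le

/-- A Gaussian integral of a function of one coordinate reduces to a one-dimensional integral. -/
lemma lintegral_coord_mul_exp_neg_mul_sum_sq (m : ℕ) {b : ℝ} (hb : 0 < b) {f : ℝ → ℝ≥0∞}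
    (hf : Measurable f) :
    ∫⁻ y : Fin (m + 1) → ℝ, f (y 0) * ENNReal.ofReal (exp (-(b * ∑ i, y i ^ 2))) =
      ENNReal.ofReal (√(π / b) ^ m) * ∫⁻ x, f x * ENNReal.ofReal (exp (-(b * x ^ 2))) := by
  have hmp := (volume_preserving_piFinSuccAbove (fun _ : Fin (m + 1) => ℝ) 0).symm
  rw [← hmp.lintegral_comp (by fun_prop), Measure.volume_eq_prod, lintegral_prod _ (by fun_prop),
    ← lintegral_const_mul _ (by fun_prop)]
  refine lintegral_congr fun x => ?_
  simp only [MeasurableEquiv.piFinSuccAbove_symm_apply, Fin.insertNthEquiv_apply,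
    Fin.insertNth_zero', Fin.sum_univ_succ, Fin.cons_zero, Fin.cons_succ]
  rw [← lintegral_exp_neg_mul_sum_sq m hb, mul_comm, ← lintegral_const_mul _ (by fun_prop)]
  refine lintegral_congr fun y => ?_
  rw [mul_add, neg_add, Real.exp_add, ENNReal.ofReal_mul (exp_pos _).le, mul_assoc]

/-- A Gaussian integral of a ridge function reduces to a one-dimensional integral. -/
lemma lintegral_inner_mul_exp_neg_mul_norm_sq (m : ℕ) {b : ℝ} (hb : 0 < b) {f : ℝ → ℝ≥0∞}
    (hf : Measurable f) {v : EuclideanSpace ℝ (Fin (m + 1))} (hv : v ≠ 0) :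
    ∫⁻ w : EuclideanSpace ℝ (Fin (m + 1)),
        f (inner ℝ v w) * ENNReal.ofReal (exp (-(b * ‖w‖ ^ 2))) =
      ENNReal.ofReal (√(π / b) ^ m) *
        ∫⁻ x, f (‖v‖ * x) * ENNReal.ofReal (exp (-(b * x ^ 2))) := by
  have hv' : ‖v‖ ≠ 0 := norm_ne_zero_iff.mpr hv
  obtain ⟨B, hB⟩ := Orthonormal.exists_orthonormalBasis_extension_of_card_eq (𝕜 := ℝ)
    (E := EuclideanSpace ℝ (Fin (m + 1))) (ι := Fin (m + 1)) (by simp)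
    (v := fun _ => ‖v‖⁻¹ • v) (s := {0}) (by
      refine ⟨fun i => ?_, fun i j hij => absurd (Subsingleton.elim i j) hij⟩
      simp [norm_smul, hv'])
  have hB0 : v = ‖v‖ • B 0 := by
    rw [hB 0 rfl, smul_smul, mul_inv_cancel₀ hv', one_smul]
  have hmp := (PiLp.volume_preserving_ofLp (Fin (m + 1))).comp B.measurePreserving_repr
  rw [← lintegral_coord_mul_exp_neg_mul_sum_sq m hb (f := fun x => f (‖v‖ * x)) (by fun_prop),
    ← hmp.lintegral_comp (by fun_prop)]
  refine lintegral_congr fun w => ?_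
  have h1 : inner ℝ v w = ‖v‖ * B.repr w 0 := by
    rw [B.repr_apply_apply]
    conv_lhs => rw [hB0]
    rw [real_inner_smul_left]
  have h2 : ‖w‖ ^ 2 = ∑ i, (B.repr w i) ^ 2 := by
    rw [← B.repr.norm_map w, EuclideanSpace.real_norm_sq_eq]
  rw [h1, h2]
  rfl

lemma sqrt_pi_div_div {s α : ℝ} (hs : 0 < s) (hα : 0 < α) :
    √(π / (s / α)) = √(α * π) / √s := by
  rw [← Real.sqrt_div (by positivity)]
  congr 1
  field_simp

/-- Integrating a ridge function against an isotropic Student-type density reduces to a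
one-dimensional integral. -/
lemma lintegral_inner_mul_student (m : ℕ) {α : ℝ} (hα : 0 < α) {f : ℝ → ℝ≥0∞}
    (hf : Measurable f) {v : EuclideanSpace ℝ (Fin (m + 1))} (hv : v ≠ 0) :
    ENNReal.ofReal (Real.Gamma ((α + (m + 1)) / 2)) *
        ∫⁻ w : EuclideanSpace ℝ (Fin (m + 1)), f (inner ℝ v w) *
          ENNReal.ofReal ((1 + ‖w‖ ^ 2 / α) ^ (-((α + (m + 1)) / 2))) =
      ENNReal.ofReal (√(α * π) ^ m) * (ENNReal.ofReal (Real.Gamma ((α + 1) / 2)) *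
        ∫⁻ x, f (‖v‖ * x) * ENNReal.ofReal ((1 + x ^ 2 / α) ^ (-((α + 1) / 2)))) := by
  rw [lintegral_mul_one_add_rpow_neg _ (by fun_prop) (by fun_prop) (fun w => by positivity)
      (by positivity),
    lintegral_mul_one_add_rpow_neg _ (by fun_prop) (by fun_prop) (fun w => by positivity)
      (by positivity), ← lintegral_const_mul' _ _ ENNReal.ofReal_ne_top]
  refine setLIntegral_congr_fun measurableSet_Ioi fun s hs => ?_
  have hs : (0 : ℝ) < s := hs
  have h1 (t : ℝ) : s * (t ^ 2 / α) = s / α * t ^ 2 := by ring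
  simp only [h1]
  rw [lintegral_inner_mul_exp_neg_mul_norm_sq m (div_pos hs hα) hf hv, ← mul_assoc, ← mul_assoc,
    ← ENNReal.ofReal_mul (by positivity), ← ENNReal.ofReal_mul (by positivity)]
  congr 2
  have h3 : s ^ ((α + (m + 1)) / 2 - 1) = s ^ ((α + 1) / 2 - 1) * √s ^ m := by
    rw [Real.sqrt_eq_rpow, ← Real.rpow_mul_natCast hs.le, ← Real.rpow_add hs]
    congr 1
    ring
  have h4 : √s ≠ 0 := (Real.sqrt_pos.mpr hs).ne'
  rw [sqrt_pi_div_div hs hα, h3, div_pow]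
  field_simp

/-- Total mass of the one-dimensional Student kernel. -/
lemma lintegral_student_kernel {α : ℝ} (hα : 0 < α) :
    ENNReal.ofReal (Real.Gamma ((α + 1) / 2)) *
        ∫⁻ x : ℝ, ENNReal.ofReal ((1 + x ^ 2 / α) ^ (-((α + 1) / 2))) =
      ENNReal.ofReal (√(α * π) * Real.Gamma (α / 2)) := by
  have h := lintegral_mul_one_add_rpow_neg (volume : Measure ℝ) (g := fun _ => 1)
    (q := fun x => x ^ 2 / α) (by fun_prop) (by fun_prop) (fun x => by positivity)
    (β := (α + 1) / 2) (by positivity)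
  simp only [one_mul] at h
  have hint := Real.integral_rpow_mul_exp_neg_mul_Ioi (half_pos hα) one_pos
  simp only [div_one, Real.one_rpow, one_mul] at hint
  have hi : IntegrableOn (fun s : ℝ => s ^ (α / 2 - 1) * exp (-s)) (Set.Ioi 0) :=
    Integrable.of_integral_ne_zero
      (by rw [hint]; exact (Real.Gamma_pos_of_pos (half_pos hα)).ne')
  rw [h, ENNReal.ofReal_mul (by positivity), ← hint, ofReal_integral_eq_lintegral_ofReal hi,
    ← lintegral_const_mul' _ _ ENNReal.ofReal_ne_top]
  · refine setLIntegral_congr_fun measurableSet_Ioi fun s hs => ?_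
    have hs : (0 : ℝ) < s := hs
    have h1 (t : ℝ) : s * (t ^ 2 / α) = s / α * t ^ 2 := by ring
    have h5 := lintegral_coord_mul_exp_neg_mul_sum_sq 0 (div_pos hs hα)
      (f := fun _ => 1) (by fun_prop)
    have h6 := lintegral_exp_neg_mul_sum_sq 1 (div_pos hs hα)
    simp only [one_mul, pow_zero, ENNReal.ofReal_one] at h5
    simp only [h1]
    rw [← h5, h6, pow_one, ← ENNReal.ofReal_mul (by positivity),
      ← ENNReal.ofReal_mul (by positivity)]
    have h3 : s ^ ((α + 1) / 2 - 1) = s ^ (α / 2 - 1) * √s := by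
      rw [Real.sqrt_eq_rpow, ← Real.rpow_add hs]
      congr 1
      ring
    have h4 : √s ≠ 0 := (Real.sqrt_pos.mpr hs).ne'
    rw [sqrt_pi_div_div hs hα, h3]
    congr 1
    field_simp
  · filter_upwards [ae_restrict_mem measurableSet_Ioi] with s hs
    have hs : (0 : ℝ) < s := hs
    simp only [Pi.zero_apply]
    positivity

/-- The lower tail of the one-dimensional Student kernel. -/
lemma toReal_lintegral_Iio_student_kernel {α : ℝ} (hα : 0 < α) {c : ℝ} (hc : 0 < c) :
    (∫⁻ x in Set.Iio (-c), ENNReal.ofReal ((1 + x ^ 2 / α) ^ (-((α + 1) / 2)))).toReal =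
      √(α * π) * Real.Gamma (α / 2) / Real.Gamma ((α + 1) / 2) / 2 -
        ∫ t in (0 : ℝ)..c, (1 + t ^ 2 / α) ^ (-((α + 1) / 2)) := by
  set h : ℝ → ℝ := fun x => (1 + x ^ 2 / α) ^ (-((α + 1) / 2)) with hh
  have hG := Real.Gamma_pos_of_pos (half_pos hα)
  have hG' := Real.Gamma_pos_of_pos (show 0 < (α + 1) / 2 by positivity)
  have hpos (x : ℝ) : 0 ≤ h x := by positivity
  have heven (x : ℝ) : h (-x) = h x := by simp [hh]
  have htot : ∫⁻ x, ENNReal.ofReal (h x) =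
      ENNReal.ofReal (√(α * π) * Real.Gamma (α / 2) / Real.Gamma ((α + 1) / 2)) := by
    rw [ENNReal.ofReal_div_of_pos hG', ← lintegral_student_kernel hα, mul_comm,
      ENNReal.mul_div_cancel_right (by simpa using hG') ENNReal.ofReal_ne_top]
  have hmeas : Measurable h := by fun_prop
  have hint : Integrable h := by
    refine ⟨hmeas.aestronglyMeasurable, ?_⟩
    rw [hasFiniteIntegral_iff_ofReal (Filter.Eventually.of_forall hpos), htot]
    exact ENNReal.ofReal_lt_top
  have htot' : ∫ x, h x = √(α * π) * Real.Gamma (α / 2) / Real.Gamma ((α + 1) / 2) := by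
    rw [integral_eq_lintegral_of_nonneg_ae (Filter.Eventually.of_forall hpos)
      hmeas.aestronglyMeasurable, htot, ENNReal.toReal_ofReal (by positivity)]
  rw [← integral_eq_lintegral_of_nonneg_ae (Filter.Eventually.of_forall hpos)
    hmeas.aestronglyMeasurable, ← integral_Iic_eq_integral_Iio]
  have e1 : ∫ x in Set.Iic (-c), h x = ∫ x in Set.Ioi c, h x := by
    rw [← integral_comp_neg_Ioi]
    simp only [heven]
  have e2 : ∫ x in Set.Iic (0 : ℝ), h x = ∫ x in Set.Ioi (0 : ℝ), h x := by
    rw [← neg_zero, ← integral_comp_neg_Ioi]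
    simp only [heven, neg_zero]
  have e3 := intervalIntegral.integral_Iic_add_Ioi (b := 0) hint.integrableOn hint.integrableOn
  have e4 := intervalIntegral.integral_Ioi_sub_Ioi (a := 0) (b := c)
    hint.integrableOn hc.le
  linarith

open scoped MatrixOrder in
/-- Integrating over a half space against a Student-type density reduces to a tail integral. -/
lemma lintegral_halfSpace_student (m : ℕ) {α A : ℝ} (hα : 0 < α)
    {Cov : Matrix (Fin (m + 1)) (Fin (m + 1)) ℝ} (hCov : Cov.PosDef)
    {e : Fin (m + 1) → ℝ} (he : e ≠ 0) :
    ENNReal.ofReal (Real.Gamma ((α + (m + 1)) / 2)) *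
        ∫⁻ n in {n : Fin (m + 1) → ℝ | e ⬝ᵥ (Cov⁻¹ *ᵥ n) < -(A * (e ⬝ᵥ (Cov⁻¹ *ᵥ e)))},
          ENNReal.ofReal ((1 + (n ⬝ᵥ (Cov⁻¹ *ᵥ n)) / α) ^ (-((α + (m + 1)) / 2))) =
      ENNReal.ofReal √Cov.det * (ENNReal.ofReal (√(α * π) ^ m) *
        (ENNReal.ofReal (Real.Gamma ((α + 1) / 2)) *
          ∫⁻ x in Set.Iio (-(A * √(e ⬝ᵥ (Cov⁻¹ *ᵥ e)))),
            ENNReal.ofReal ((1 + x ^ 2 / α) ^ (-((α + 1) / 2))))) := by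
  obtain ⟨R, hR⟩ := CStarAlgebra.nonneg_iff_eq_star_mul_self.mp hCov.inv.posSemidef.nonneg
  rw [star_eq_conjTranspose, conjTranspose_eq_transpose_of_trivial] at hR
  have hdot (x y : Fin (m + 1) → ℝ) : x ⬝ᵥ (Cov⁻¹ *ᵥ y) =
      inner ℝ (WithLp.toLp 2 (R *ᵥ x)) (WithLp.toLp 2 (R *ᵥ y)) := by
    rw [EuclideanSpace.inner_toLp_toLp, hR, ← mulVec_mulVec, dotProduct_mulVec, vecMul_transpose,
      star_trivial, dotProduct_comm]
  have hdet : Cov.det * R.det ^ 2 = 1 := by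
    have := congrArg det hR
    rw [det_nonsing_inv, Ring.inverse_eq_inv', det_mul, det_transpose] at this
    rw [sq, ← this, mul_inv_cancel₀ hCov.det_pos.ne']
  have hR0 : R.det ≠ 0 := by
    rintro h
    simp [h] at hdet
  have hRabs : |R.det⁻¹| = √Cov.det := by
    rw [← Real.sqrt_sq_eq_abs]
    congr 1
    field_simp
    linarith
  set v : EuclideanSpace ℝ (Fin (m + 1)) := WithLp.toLp 2 (R *ᵥ e) with hv
  have hv0 : v ≠ 0 := by
    intro h
    have h1 := hCov.inv.dotProduct_mulVec_pos he
    rw [star_trivial, hdot, ← hv, h, inner_zero_left] at h1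
    exact h1.false
  have hvn : 0 < ‖v‖ := norm_pos_iff.mpr hv0
  have hee : e ⬝ᵥ (Cov⁻¹ *ᵥ e) = ‖v‖ ^ 2 := by rw [hdot, real_inner_self_eq_norm_sq]
  rw [hee, Real.sqrt_sq hvn.le]
  set f : ℝ → ℝ≥0∞ := (Set.Iio (-(A * ‖v‖ ^ 2))).indicator 1 with hf
  have hfm : Measurable f := measurable_one.indicator measurableSet_Iio
  have hmap := Real.map_matrix_volume_pi_eq_smul_volume_pi hR0
  have hRm : Measurable (toLin' R) := (LinearMap.continuous_of_finiteDimensional _).measurable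
  set F : EuclideanSpace ℝ (Fin (m + 1)) → ℝ≥0∞ := fun w => f (inner ℝ v w) *
    ENNReal.ofReal ((1 + ‖w‖ ^ 2 / α) ^ (-((α + (m + 1)) / 2))) with hF
  have hFm : Measurable F := by fun_prop
  have hL : ∫⁻ n in {n : Fin (m + 1) → ℝ | e ⬝ᵥ (Cov⁻¹ *ᵥ n) < -(A * ‖v‖ ^ 2)},
      ENNReal.ofReal ((1 + (n ⬝ᵥ (Cov⁻¹ *ᵥ n)) / α) ^ (-((α + (m + 1)) / 2))) =
      ENNReal.ofReal √Cov.det * ∫⁻ w, F w := by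
    rw [← (PiLp.volume_preserving_toLp (Fin (m + 1))).lintegral_comp hFm, ← hRabs,
      ← smul_eq_mul (ENNReal.ofReal _), ← lintegral_smul_measure, ← hmap, lintegral_map (by fun_prop) hRm,
      ← lintegral_indicator]
    · refine lintegral_congr fun n => ?_
      simp only [hF, hf, toLin'_apply, Set.indicator_apply, Set.mem_ofPred_eq, Set.mem_Iio, hdot,
        ← hv, real_inner_self_eq_norm_sq]
      split_ifs <;> simp
    · refine measurableSet_lt ?_ measurable_const
      simp only [dotProduct, mulVec]
      fun_prop
  have hTail : ∫⁻ x, f (‖v‖ * x) * ENNReal.ofReal ((1 + x ^ 2 / α) ^ (-((α + 1) / 2))) =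
      ∫⁻ x in Set.Iio (-(A * ‖v‖)), ENNReal.ofReal ((1 + x ^ 2 / α) ^ (-((α + 1) / 2))) := by
    rw [← lintegral_indicator measurableSet_Iio]
    refine lintegral_congr fun x => ?_
    have hiff : ‖v‖ * x < -(A * ‖v‖ ^ 2) ↔ x < -(A * ‖v‖) := by
      rw [← mul_lt_mul_iff_right₀ hvn (b := x)]
      ring_nf
    simp only [hf, Set.indicator_apply, Set.mem_Iio, hiff]
    split_ifs <;> simp
  rw [hL, mul_left_comm, lintegral_inner_mul_student m hα hfm hv0, hTail]

/-- Theorem 3: asymptotic bit error probability of ML demodulation of BPSK (and QPSK) in GS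
bursty mixed noise. With `P₀ = A·e_pᵀΣ⁻¹e_p`, `λ = √(e_pᵀΣ⁻¹e_p)` (so `P₀/λ = A√(e_pᵀΣ⁻¹e_p)`),
`P̂_e = ∫_{e_pᵀΣ⁻¹n < −P₀} (1−ρ)k₂(1 + nᵀΣ⁻¹n/α)^{−(α+p)/2} dn
     = (1−ρ)[1/2 − c_α ∫₀^{P₀/λ}(1 + t²/α)^{−(α+1)/2} dt]`. -/
theorem asymptotic_BER_BPSK (p : ℕ) (hp : 2 ≤ p) (α ρ A : ℝ)
    (hα : 0 < α) (hρ : ρ ∈ Set.Icc (0 : ℝ) 1) (hA : 0 < A)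
    (Cov : Matrix (Fin p) (Fin p) ℝ) (hCov : Cov.PosDef) :
    (∫ n in {n : Fin p → ℝ | (fun _ => (1 : ℝ)) ⬝ᵥ (Cov⁻¹ *ᵥ n)
          < -(A * ((fun _ => (1 : ℝ)) ⬝ᵥ (Cov⁻¹ *ᵥ (fun _ => (1 : ℝ)))))},
        (1 - ρ) *
          (Real.Gamma ((α + p) / 2) /
            (Real.Gamma (α / 2) * (α * π) ^ ((p : ℝ) / 2) * Real.sqrt Cov.det)) *
          (1 + (n ⬝ᵥ (Cov⁻¹ *ᵥ n)) / α) ^ (-(α + (p : ℝ)) / 2))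
      = (1 - ρ) *
          (1 / 2 - (Real.Gamma ((α + 1) / 2) / (Real.Gamma (α / 2) * Real.sqrt (α * π))) *
            ∫ t in (0 : ℝ)..(A * Real.sqrt ((fun _ => (1 : ℝ)) ⬝ᵥ (Cov⁻¹ *ᵥ (fun _ => (1 : ℝ))))),
              (1 + t ^ 2 / α) ^ (-(α + 1) / 2)) := by
  obtain ⟨m, rfl⟩ : ∃ m, p = m + 1 := ⟨p - 1, by omega⟩
  set e : Fin (m + 1) → ℝ := fun _ => 1 with he
  have he0 : e ≠ 0 := fun h => one_ne_zero (congrFun h 0)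
  have hlam : 0 < e ⬝ᵥ (Cov⁻¹ *ᵥ e) := by
    simpa using hCov.inv.dotProduct_mulVec_pos he0
  have hG := Real.Gamma_pos_of_pos (half_pos hα)
  have hG1 := Real.Gamma_pos_of_pos (show 0 < (α + 1) / 2 by positivity)
  have hGp := Real.Gamma_pos_of_pos (show 0 < (α + (m + 1)) / 2 by positivity)
  have hd := Real.sqrt_pos.mpr hCov.det_pos
  have hap : 0 < √(α * π) := by positivity
  have hc : 0 < A * √(e ⬝ᵥ (Cov⁻¹ *ᵥ e)) := by positivity
  have hquad (n : Fin (m + 1) → ℝ) : 0 ≤ n ⬝ᵥ (Cov⁻¹ *ᵥ n) := by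
    simpa using hCov.inv.posSemidef.dotProduct_mulVec_nonneg n
  have key := lintegral_halfSpace_student m (A := A) hα hCov he0
  have hpow : (α * π) ^ (((m + 1 : ℕ) : ℝ) / 2) = √(α * π) ^ m * √(α * π) := by
    rw [← pow_succ, Real.sqrt_eq_rpow, ← Real.rpow_mul_natCast (by positivity)]
    congr 1
    ring
  have hreal := congrArg ENNReal.toReal key
  simp only [ENNReal.toReal_mul, ENNReal.toReal_ofReal hGp.le, ENNReal.toReal_ofReal hd.le,
    ENNReal.toReal_ofReal hG1.le, ENNReal.toReal_ofReal (pow_nonneg hap.le m),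
    toReal_lintegral_Iio_student_kernel hα hc] at hreal
  rw [← integral_eq_lintegral_of_nonneg_ae] at hreal
  · rw [integral_const_mul, hpow]
    push_cast
    simp only [neg_div]
    set I := ∫ n in {n : Fin (m + 1) → ℝ | e ⬝ᵥ (Cov⁻¹ *ᵥ n) < -(A * (e ⬝ᵥ (Cov⁻¹ *ᵥ e)))},
      (1 + (n ⬝ᵥ (Cov⁻¹ *ᵥ n)) / α) ^ (-((α + (m + 1)) / 2))
    set J := ∫ t in (0 : ℝ)..(A * √(e ⬝ᵥ (Cov⁻¹ *ᵥ e))), (1 + t ^ 2 / α) ^ (-((α + 1) / 2))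
    rw [mul_assoc, div_mul_eq_mul_div, hreal]
    field_simp
  · exact Filter.Eventually.of_forall fun n =>
      Real.rpow_nonneg (add_nonneg zero_le_one (div_nonneg (hquad n) hα.le)) _
  · refine Measurable.aestronglyMeasurable ?_
    simp only [dotProduct, mulVec]
    fun_prop
end

section
/- Let p ≥ 1 be an integer, α > 0, ρ ∈ [0,1], Σ ∈ ℝ^{p×p} symmetric positive definite, and Δs ∈ ℝ^p nonzero. With k₂ = Γ((α+p)/2)/(Γ(α/2)(απ)^{p/2}√(det Σ)), c_α = Γ((α+1)/2)/(Γ(α/2)√(απ)) and δ = √(ΔsᵀΣ⁻¹Δs)/2, it holds that (1−ρ)·∫_{{n ∈ ℝ^p : (n+Δs)ᵀΣ⁻¹(n+Δs) < nᵀΣ⁻¹n}} k₂·(1 + nᵀΣ⁻¹n/α)^{−(α+p)/2} dn = (1−ρ)·[1/2 − c_α·∫₀^{δ} (1 + t²/α)^{−(α+1)/2} dt]. -/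
open Matrix Real MeasureTheory

/-- The integral of a radial function over a half-space with normal `u`, with the direction of `u`
split off. -/
theorem lintegral_halfspace_radial {E : Type*} [NormedAddCommGroup E] [InnerProductSpace ℝ E]
    [FiniteDimensional ℝ E] [MeasurableSpace E] [BorelSpace E] {u : E} (hu : u ≠ 0)
    {φ : ℝ → ENNReal} (hφ : Measurable φ) :
    ∫⁻ z in {z : E | 2 * inner ℝ u z + ‖u‖ ^ 2 < 0}, φ (‖z‖ ^ 2) =
      ∫⁻ t in Set.Iio (-(‖u‖ / 2)), ∫⁻ w : (ℝ ∙ u)ᗮ, φ (t ^ 2 + ‖w‖ ^ 2) := by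
  have hu' : 0 < ‖u‖ := norm_pos_iff.mpr hu
  let v : E := ‖u‖⁻¹ • u
  have hv : ‖v‖ = 1 := by simp [v, norm_smul, hu'.ne']
  have huv : u = ‖u‖ • v := by simp [v, smul_smul, hu'.ne']
  have hspan : (ℝ ∙ u) = (ℝ ∙ v) := by
    rw [show v = ‖u‖⁻¹ • u from rfl,
      Submodule.span_singleton_smul_eq (IsUnit.mk0 _ (inv_ne_zero hu'.ne'))]
  rw [hspan]
  let e : WithLp 2 (ℝ × (ℝ ∙ v)ᗮ) ≃ₗᵢ[ℝ] E :=
    (LinearIsometryEquiv.withLpProdCongr 2 (LinearIsometryEquiv.toSpanUnitSingleton v hv)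
      (LinearIsometryEquiv.refl ℝ (ℝ ∙ v)ᗮ)).trans (ℝ ∙ v).orthogonalDecomposition.symm
  let f : ℝ × (ℝ ∙ v)ᗮ → E := fun x ↦ e (WithLp.toLp 2 x)
  have hf : ∀ x, f x = x.1 • v + x.2 := fun x ↦ by simp [f, e]
  have hmp : MeasurePreserving f (volume.prod volume) volume :=
    e.measurePreserving.comp (WithLp.volume_preserving_toLp ℝ (ℝ ∙ v)ᗮ)
  have hw : ∀ w : (ℝ ∙ v)ᗮ, inner ℝ v (w : E) = 0 := fun w ↦
    Submodule.mem_orthogonal_singleton_iff_inner_right.mp w.2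
  have hin : ∀ x, inner ℝ u (f x) = ‖u‖ * x.1 := fun x ↦ by
    rw [hf, huv, inner_smul_left, inner_add_right, inner_smul_right, hw]
    simp [hv, norm_smul]
  have hnorm : ∀ x, ‖f x‖ ^ 2 = x.1 ^ 2 + ‖x.2‖ ^ 2 := fun x ↦ by
    simp [f, WithLp.prod_norm_sq_eq_of_L2]
  have hs : MeasurableSet {z : E | 2 * inner ℝ u z + ‖u‖ ^ 2 < 0} :=
    measurableSet_lt (by fun_prop) (by fun_prop)
  have hpre : f ⁻¹' {z : E | 2 * inner ℝ u z + ‖u‖ ^ 2 < 0} =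
      Set.Iio (-(‖u‖ / 2)) ×ˢ Set.univ := by
    ext x
    simp only [Set.mem_preimage, Set.mem_ofPred_eq, hin, Set.mem_prod, Set.mem_Iio, Set.mem_univ,
      and_true]
    constructor <;> intro h <;> nlinarith
  rw [← hmp.setLIntegral_comp_preimage hs (by fun_prop), hpre]
  simp only [hnorm]
  rw [← Measure.prod_restrict, Measure.restrict_univ, lintegral_prod _ (by fun_prop)]

theorem lintegral_rexp_neg_mul_sq_norm {V : Type*} [NormedAddCommGroup V] [InnerProductSpace ℝ V]
    [FiniteDimensional ℝ V] [MeasurableSpace V] [BorelSpace V] {b : ℝ} (hb : 0 < b) :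
    ∫⁻ v : V, ENNReal.ofReal (rexp (-b * ‖v‖ ^ 2)) =
      ENNReal.ofReal ((π / b) ^ (Module.finrank ℝ V / 2 : ℝ)) := by
  rw [← GaussianFourier.integral_rexp_neg_mul_sq_norm hb, ofReal_integral_eq_lintegral_ofReal]
  · by_contra h
    have := GaussianFourier.integral_rexp_neg_mul_sq_norm (V := V) hb
    rw [integral_undef h] at this
    have : 0 < (π / b) ^ (Module.finrank ℝ V / 2 : ℝ) := by positivity
    linarith
  · exact .of_forall fun _ ↦ (exp_pos _).le

theorem lintegral_rpow_mul_exp_neg_mul_Ioi {a r : ℝ} (ha : 0 < a) (hr : 0 < r) :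
    ∫⁻ s in Set.Ioi (0 : ℝ), ENNReal.ofReal (s ^ (a - 1) * rexp (-(r * s))) =
      ENNReal.ofReal (Gamma a * r ^ (-a)) := by
  have h := Real.integral_rpow_mul_exp_neg_mul_Ioi ha hr
  have h' : (1 / r) ^ a * Gamma a = Gamma a * r ^ (-a) := by
    rw [one_div, inv_rpow hr.le, rpow_neg hr.le, mul_comm]
  rw [← h', ← h, ofReal_integral_eq_lintegral_ofReal]
  · by_contra hi
    rw [integral_undef hi] at h
    have := Gamma_pos_of_pos ha
    have : 0 < (1 / r) ^ a * Gamma a := by positivity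
    linarith
  · filter_upwards [ae_restrict_mem measurableSet_Ioi] with s (hs : 0 < s)
    simp only [Pi.zero_apply]
    positivity

/-- Integrating a Student-type kernel over a Euclidean space lowers its exponent by half the
dimension; proved by writing the kernel as a Gamma mixture of Gaussians. -/
theorem lintegral_student_kernel_s12 {V : Type*} [NormedAddCommGroup V] [InnerProductSpace ℝ V]
    [FiniteDimensional ℝ V] [MeasurableSpace V] [BorelSpace V] {a α β : ℝ} (ha : 0 < a)
    (hα : 0 < α) (hβ : 0 < β) :
    ∫⁻ w : V, ENNReal.ofReal (Gamma (β + Module.finrank ℝ V / 2) *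
        (a + ‖w‖ ^ 2 / α) ^ (-(β + Module.finrank ℝ V / 2))) =
      ENNReal.ofReal ((α * π) ^ (Module.finrank ℝ V / 2 : ℝ) * (Gamma β * a ^ (-β))) := by
  set d : ℝ := Module.finrank ℝ V / 2 with hd
  have hd0 : 0 ≤ d := by positivity
  calc
    _ = ∫⁻ w : V, ∫⁻ s in Set.Ioi (0 : ℝ),
        ENNReal.ofReal (s ^ (β + d - 1) * rexp (-((a + ‖w‖ ^ 2 / α) * s))) := by
      refine lintegral_congr fun w ↦ ?_
      rw [lintegral_rpow_mul_exp_neg_mul_Ioi (by positivity) (by positivity)]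
    _ = ∫⁻ s in Set.Ioi (0 : ℝ), ∫⁻ w : V,
        ENNReal.ofReal (s ^ (β + d - 1) * rexp (-((a + ‖w‖ ^ 2 / α) * s))) :=
      lintegral_lintegral_swap (by fun_prop)
    _ = ∫⁻ s in Set.Ioi (0 : ℝ), ENNReal.ofReal ((α * π) ^ d) *
        ENNReal.ofReal (s ^ (β - 1) * rexp (-(a * s))) := by
      refine setLIntegral_congr_fun measurableSet_Ioi fun s (hs : 0 < s) ↦ ?_
      have hsplit : ∀ w : V,
          ENNReal.ofReal (s ^ (β + d - 1) * rexp (-((a + ‖w‖ ^ 2 / α) * s))) =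
          ENNReal.ofReal (s ^ (β + d - 1) * rexp (-(a * s))) *
            ENNReal.ofReal (rexp (-(s / α) * ‖w‖ ^ 2)) := fun w ↦ by
        rw [← ENNReal.ofReal_mul (by positivity), mul_assoc, ← exp_add]
        congr 3
        ring
      simp only [hsplit]
      rw [lintegral_const_mul _ (by fun_prop), lintegral_rexp_neg_mul_sq_norm (by positivity),
        ← ENNReal.ofReal_mul (by positivity), ← ENNReal.ofReal_mul (by positivity), ← hd]
      congr 1
      rw [show π / (s / α) = α * π / s by field_simp, div_rpow (by positivity) hs.le,
        show β + d - 1 = β - 1 + d by ring, rpow_add hs]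
      field_simp
    _ = _ := by
      rw [lintegral_const_mul _ (by fun_prop), lintegral_rpow_mul_exp_neg_mul_Ioi hβ ha,
        ← ENNReal.ofReal_mul (by positivity)]

/-- The whitening change of variables turns the quadratic form of `C⁻¹` into the Euclidean norm. -/
theorem exists_lintegral_halfspace_quadraticForm {ι : Type*} [Fintype ι] [DecidableEq ι]
    {C : Matrix ι ι ℝ} (hC : C.PosDef) (x : ι → ℝ) {φ : ℝ → ENNReal} (hφ : Measurable φ) :
    ∃ u : EuclideanSpace ℝ ι, ‖u‖ ^ 2 = x ⬝ᵥ (C⁻¹ *ᵥ x) ∧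
      ∫⁻ n in {n : ι → ℝ | (n + x) ⬝ᵥ (C⁻¹ *ᵥ (n + x)) < n ⬝ᵥ (C⁻¹ *ᵥ n)},
          φ (n ⬝ᵥ (C⁻¹ *ᵥ n)) =
        ENNReal.ofReal (√C.det) *
          ∫⁻ z in {z : EuclideanSpace ℝ ι | 2 * inner ℝ u z + ‖u‖ ^ 2 < 0}, φ (‖z‖ ^ 2) := by
  obtain ⟨B, hB⟩ : ∃ B : Matrix ι ι ℝ, C⁻¹ = Bᵀ * B := by
    open scoped MatrixOrder in
    obtain ⟨B, hB⟩ := CStarAlgebra.nonneg_iff_eq_star_mul_self.mp hC.inv.posSemidef.nonneg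
    exact ⟨B, hB⟩
  have hdet : C.det⁻¹ = B.det ^ 2 := by
    rw [← Ring.inverse_eq_inv', ← Matrix.det_nonsing_inv, hB, det_mul, det_transpose, sq]
  have hB0 : B.det ≠ 0 := fun h ↦ by
    rw [h] at hdet
    exact hC.det_pos.ne' (by simpa using hdet)
  have habs : |B.det⁻¹| = √C.det := by
    rw [← sqrt_sq_eq_abs, inv_pow, ← hdet, inv_inv]
  have hq : ∀ y z : ι → ℝ, y ⬝ᵥ (C⁻¹ *ᵥ z) =
      inner ℝ (WithLp.toLp 2 (B *ᵥ y)) (WithLp.toLp 2 (B *ᵥ z)) := fun y z ↦ by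
    rw [EuclideanSpace.inner_toLp_toLp, star_trivial, hB, ← mulVec_mulVec, dotProduct_mulVec,
      vecMul_transpose, dotProduct_comm]
  have hqn : ∀ y : ι → ℝ, y ⬝ᵥ (C⁻¹ *ᵥ y) = ‖WithLp.toLp 2 (B *ᵥ y)‖ ^ 2 := fun y ↦ by
    rw [hq, real_inner_self_eq_norm_sq]
  refine ⟨WithLp.toLp 2 (B *ᵥ x), (hqn x).symm, ?_⟩
  set u : EuclideanSpace ℝ ι := WithLp.toLp 2 (B *ᵥ x) with hu
  have hs : MeasurableSet {z : EuclideanSpace ℝ ι | 2 * inner ℝ u z + ‖u‖ ^ 2 < 0} :=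
    measurableSet_lt (by fun_prop) (by fun_prop)
  have hL : Measurable (toLin' B) := (toLin' B).continuous_of_finiteDimensional.measurable
  have hto := PiLp.volume_preserving_toLp ι
  rw [← hto.setLIntegral_comp_preimage hs (by fun_prop), ← habs, ← smul_eq_mul,
    ← lintegral_smul_measure, ← Measure.restrict_smul,
    ← Real.map_matrix_volume_pi_eq_smul_volume_pi hB0,
    setLIntegral_map (hto.measurable hs) (by fun_prop) hL]
  simp only [toLin'_apply, hqn]
  congr 2
  ext n
  simp only [Set.mem_ofPred_eq, Set.mem_preimage, toLin'_apply, mulVec_add, WithLp.toLp_add, ← hu]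
  rw [norm_add_sq_real, real_inner_comm]
  constructor <;> intro h <;> linarith

theorem lintegral_student_kernel_real {α : ℝ} (hα : 0 < α) :
    ∫⁻ t : ℝ, ENNReal.ofReal (Gamma ((α + 1) / 2) * (1 + t ^ 2 / α) ^ (-(α + 1) / 2)) =
      ENNReal.ofReal (Gamma (α / 2) * √(α * π)) := by
  have h := lintegral_student_kernel_s12 (V := ℝ) one_pos hα (half_pos hα)
  simp only [Module.finrank_self, Nat.cast_one, ← add_div, norm_eq_abs, sq_abs, one_rpow, mul_one,
    ← neg_div, ← sqrt_eq_rpow] at h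
  rw [h, mul_comm]

theorem integrable_student_kernel {α : ℝ} (hα : 0 < α) :
    Integrable fun t : ℝ ↦ (1 + t ^ 2 / α) ^ (-(α + 1) / 2) := by
  have hΓ := Gamma_pos_of_pos (show 0 < (α + 1) / 2 by positivity)
  rw [← integrable_const_mul_iff (IsUnit.mk0 _ hΓ.ne')]
  refine (lintegral_ofReal_ne_top_iff_integrable (Measurable.aestronglyMeasurable (by fun_prop))
    (.of_forall fun t ↦ ?_)).mp ?_
  · simp only [Pi.zero_apply]
    positivity
  · rw [lintegral_student_kernel_real hα]
    exact ENNReal.ofReal_ne_top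

theorem integral_student_kernel {α : ℝ} (hα : 0 < α) :
    Gamma ((α + 1) / 2) / (Gamma (α / 2) * √(α * π)) *
      ∫ t : ℝ, (1 + t ^ 2 / α) ^ (-(α + 1) / 2) = 1 := by
  have hΓ := Gamma_pos_of_pos (show 0 < (α + 1) / 2 by positivity)
  have hΓ' := Gamma_pos_of_pos (half_pos hα)
  have h : Gamma ((α + 1) / 2) * ∫ t : ℝ, (1 + t ^ 2 / α) ^ (-(α + 1) / 2) =
      Gamma (α / 2) * √(α * π) := by
    rw [← integral_const_mul, integral_eq_lintegral_of_nonneg_ae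
      (.of_forall fun t ↦ by simp only [Pi.zero_apply]; positivity)
      (Measurable.aestronglyMeasurable (by fun_prop)),
      lintegral_student_kernel_real hα, ENNReal.toReal_ofReal (by positivity)]
  rw [div_mul_eq_mul_div, h, div_self (by positivity)]

/-- The lower tail of an even integrable function. -/
theorem integral_Iio_neg_of_even {g : ℝ → ℝ} (hg : Integrable g) (heven : ∀ t, g (-t) = g t)
    (δ : ℝ) :
    ∫ t in Set.Iio (-δ), g t = (∫ t, g t) / 2 - ∫ t in (0 : ℝ)..δ, g t := by
  have hneg : ∫ t in Set.Iio (-δ), g t = ∫ t in Set.Ioi δ, g t := by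
    have h := integral_comp_neg_Iic (-δ) g
    simp only [heven, neg_neg] at h
    rw [← integral_Iic_eq_integral_Iio, h]
  have htotal : ∫ t, g t = 2 * ∫ t in Set.Ioi 0, g t := by
    rw [← integral_comp_abs]
    refine integral_congr_ae (.of_forall fun t ↦ ?_)
    rcases abs_choice t with h | h <;> simp [h, heven]
  have hadd := intervalIntegral.integral_interval_add_Ioi (a := 0) (b := δ)
    hg.integrableOn hg.integrableOn
  linarith

/-- The mass that a multivariate Student-t density puts on the half-space where it is dominated by
its translate, as a univariate Student-t tail. -/
theorem lintegral_student_halfspace {p : ℕ} {α : ℝ} (hα : 0 < α)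
    {C : Matrix (Fin p) (Fin p) ℝ} (hC : C.PosDef) {x : Fin p → ℝ} (hx : x ≠ 0) :
    ∫⁻ n in {n : Fin p → ℝ | (n + x) ⬝ᵥ (C⁻¹ *ᵥ (n + x)) < n ⬝ᵥ (C⁻¹ *ᵥ n)},
        ENNReal.ofReal (Gamma ((α + p) / 2) /
            (Gamma (α / 2) * (α * π) ^ ((p : ℝ) / 2) * √C.det) *
          (1 + (n ⬝ᵥ (C⁻¹ *ᵥ n)) / α) ^ (-(α + (p : ℝ)) / 2)) =
      ∫⁻ t in Set.Iio (-(√(x ⬝ᵥ (C⁻¹ *ᵥ x)) / 2)),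
        ENNReal.ofReal (Gamma ((α + 1) / 2) / (Gamma (α / 2) * √(α * π)) *
          (1 + t ^ 2 / α) ^ (-(α + 1) / 2)) := by
  have hΓ := Gamma_pos_of_pos (show 0 < (α + 1) / 2 by positivity)
  have hΓ' := Gamma_pos_of_pos (half_pos hα)
  have hdet := hC.det_pos
  have hφ : Measurable fun q : ℝ ↦ ENNReal.ofReal (Gamma ((α + p) / 2) /
      (Gamma (α / 2) * (α * π) ^ ((p : ℝ) / 2) * √C.det) *
        (1 + q / α) ^ (-(α + (p : ℝ)) / 2)) := by fun_prop
  obtain ⟨u, hu, hint⟩ := exists_lintegral_halfspace_quadraticForm hC x hφ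
  have hu0 : u ≠ 0 := by
    rintro rfl
    have := hC.inv.dotProduct_mulVec_pos hx
    simp only [star_trivial] at this
    simp only [norm_zero] at hu
    linarith
  have hdim : (p : ℝ) = 1 + Module.finrank ℝ (ℝ ∙ u)ᗮ := by
    have h := (ℝ ∙ u).finrank_add_finrank_orthogonal
    rw [finrank_span_singleton hu0, finrank_euclideanSpace_fin] at h
    exact_mod_cast h.symm
  rw [hint, lintegral_halfspace_radial hu0 hφ, ← hu, sqrt_sq (norm_nonneg u),
    ← lintegral_const_mul' _ _ ENNReal.ofReal_ne_top]
  refine lintegral_congr fun t ↦ ?_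
  have hmarg := lintegral_student_kernel_s12 (V := (ℝ ∙ u)ᗮ) (a := 1 + t ^ 2 / α) (by positivity) hα
    (show 0 < (α + 1) / 2 by positivity)
  have hexp : (α + 1) / 2 + (Module.finrank ℝ (ℝ ∙ u)ᗮ : ℝ) / 2 = (α + p) / 2 := by
    rw [hdim]; ring
  have hpow : (α * π) ^ ((p : ℝ) / 2) =
      √(α * π) * (α * π) ^ ((Module.finrank ℝ (ℝ ∙ u)ᗮ : ℝ) / 2) := by
    rw [hdim, add_div, rpow_add (by positivity), ← sqrt_eq_rpow]
  rw [hexp] at hmarg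
  have hfactor : ∀ w : (ℝ ∙ u)ᗮ, ENNReal.ofReal (Gamma ((α + p) / 2) /
        (Gamma (α / 2) * (α * π) ^ ((p : ℝ) / 2) * √C.det) *
          (1 + (t ^ 2 + ‖w‖ ^ 2) / α) ^ (-(α + (p : ℝ)) / 2)) =
      ENNReal.ofReal (Gamma (α / 2) * (α * π) ^ ((p : ℝ) / 2) * √C.det)⁻¹ *
        ENNReal.ofReal (Gamma ((α + p) / 2) *
          (1 + t ^ 2 / α + ‖w‖ ^ 2 / α) ^ (-((α + p) / 2))) := fun w ↦ by
    rw [← ENNReal.ofReal_mul (by positivity), add_div (t ^ 2), ← add_assoc, neg_div]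
    congr 1
    ring
  simp only [hfactor]
  rw [lintegral_const_mul' _ _ ENNReal.ofReal_ne_top, hmarg, ← ENNReal.ofReal_mul (by positivity),
    ← ENNReal.ofReal_mul (by positivity), hpow, neg_div]
  congr 1
  field_simp

/-- The impulsive-noise part of the upper bound on the MSK Viterbi BER: with
`δ = √(ΔsᵀΣ⁻¹Δs)/2`,
`(1−ρ)∫_{(n+Δs)ᵀΣ⁻¹(n+Δs) < nᵀΣ⁻¹n} k₂(1 + nᵀΣ⁻¹n/α)^{−(α+p)/2} dn
  = (1−ρ)[1/2 − c_α ∫₀^δ (1+t²/α)^{−(α+1)/2} dt]`. -/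
theorem MSK_upper_bound_impulsive_part (p : ℕ) (hp : 1 ≤ p) (α ρ : ℝ)
    (hα : 0 < α) (hρ : ρ ∈ Set.Icc (0 : ℝ) 1)
    (Cov : Matrix (Fin p) (Fin p) ℝ) (hCov : Cov.PosDef)
    (Δs : Fin p → ℝ) (hΔs : Δs ≠ 0) :
    ((1 - ρ) *
        ∫ n in {n : Fin p → ℝ | (n + Δs) ⬝ᵥ (Cov⁻¹ *ᵥ (n + Δs)) < n ⬝ᵥ (Cov⁻¹ *ᵥ n)},
          (Real.Gamma ((α + p) / 2) /
              (Real.Gamma (α / 2) * (α * π) ^ ((p : ℝ) / 2) * Real.sqrt Cov.det)) *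
            (1 + (n ⬝ᵥ (Cov⁻¹ *ᵥ n)) / α) ^ (-(α + (p : ℝ)) / 2))
      = (1 - ρ) *
          (1 / 2 - (Real.Gamma ((α + 1) / 2) / (Real.Gamma (α / 2) * Real.sqrt (α * π))) *
            ∫ t in (0 : ℝ)..(Real.sqrt (Δs ⬝ᵥ (Cov⁻¹ *ᵥ Δs)) / 2),
              (1 + t ^ 2 / α) ^ (-(α + 1) / 2)) := by
  have hΓ' := Gamma_pos_of_pos (half_pos hα)
  have hΓp := Gamma_pos_of_pos (show 0 < (α + p) / 2 by positivity)
  have hΓ := Gamma_pos_of_pos (show 0 < (α + 1) / 2 by positivity)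
  have hQ : ∀ n : Fin p → ℝ, 0 ≤ n ⬝ᵥ (Cov⁻¹ *ᵥ n) := fun n ↦ by
    simpa using hCov.inv.posSemidef.dotProduct_mulVec_nonneg n
  have hQm : Measurable fun n : Fin p → ℝ ↦ n ⬝ᵥ (Cov⁻¹ *ᵥ n) :=
    Continuous.measurable (by fun_prop)
  congr 1
  rw [integral_eq_lintegral_of_nonneg_ae
      (.of_forall fun n ↦ by have := hQ n; simp only [Pi.zero_apply]; positivity)
      (Measurable.aestronglyMeasurable (by fun_prop)),
    lintegral_student_halfspace hα hCov hΔs,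
    ← integral_eq_lintegral_of_nonneg_ae
      (.of_forall fun t ↦ by simp only [Pi.zero_apply]; positivity)
      (Measurable.aestronglyMeasurable (by fun_prop)),
    integral_const_mul,
    integral_Iio_neg_of_even (integrable_student_kernel hα) (fun t ↦ by rw [neg_sq]), mul_sub,
    ← mul_div_assoc, integral_student_kernel hα]
end
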